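/- Let k ≥ 1 and let C₁,…,C_k be closed cones in ℝ^p, and let H̄ = {Σ_{i=1}^k u_i : u_i ∈ C_i for each i and Σ_{i=1}^k ‖u_i‖₂ ≤ 1}. Then the Gaussian width of H̄ satisfies w(H̄) ≤ max_{1 ≤ i ≤ k} w(C_i ∩ B_p) + √(2 log k) + √(π/2), where B_p is the closed unit Euclidean ball in ℝ^p. -/

import Mathlib

open scoped RealInnerProductSpace BigOperators
open MeasureTheory

/-- A cone in `ℝ^p`: contains `0` and is closed under nonnegative scaling. -/
def IsCone {p : ℕ} (C : Set (EuclideanSpace ℝ (Fin p))) : Prop :=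
  (0 : EuclideanSpace ℝ (Fin p)) ∈ C ∧ ∀ t : ℝ, 0 ≤ t → ∀ x ∈ C, t • x ∈ C

/-- The Gaussian width `w(T) = E[sup_{u ∈ T} ⟪g, u⟫]`, where `g ~ N(0, I_p)`. -/
noncomputable def gaussianWidth {p : ℕ} (T : Set (EuclideanSpace ℝ (Fin p))) : ℝ :=
  ∫ g : Fin p → ℝ,
    sSup ((fun u : EuclideanSpace ℝ (Fin p) => ∑ i, g i * u i) '' T)
      ∂(Measure.pi fun _ : Fin p => ProbabilityTheory.gaussianReal 0 1)

open Filter Topology in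
/-- The monotone transport map between two positive continuous integrable densities on `ℝ`. -/
theorem exists_monotone_transport {u v : ℝ → ℝ} (hu : Continuous u) (hv : Continuous v)
    (hu0 : ∀ x, 0 < u x) (hv0 : ∀ x, 0 < v x) (hui : Integrable u) (hvi : Integrable v) :
    ∃ T : ℝ → ℝ, StrictMono T ∧ ∀ y,
      HasDerivAt T ((v y / ∫ x, v x) / (u (T y) / ∫ x, u x)) y := by
  have key : ∀ {w : ℝ → ℝ}, Continuous w → (∀ x, 0 < w x) → Integrable w →
      0 < (∫ x, w x) ∧ ∃ W : ℝ → ℝ, StrictMono W ∧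
        (∀ x, HasStrictDerivAt W (w x / ∫ x, w x) x) ∧
        (Tendsto W atTop (𝓝 1)) ∧ (Tendsto W atBot (𝓝 0)) := by
    intro w hw hw0 hwi
    have hZ : 0 < ∫ x, w x :=
      integral_pos_of_integrable_nonneg_nonzero hw hwi (fun x => (hw0 x).le) (hw0 0).ne'
    have hderiv : ∀ x, HasStrictDerivAt (fun x => (∫ y in Set.Iic x, w y) / ∫ x, w x)
        (w x / ∫ x, w x) x := by
      intro x
      have h1 : (fun x => ∫ y in Set.Iic x, w y)
          = fun x => (∫ y in Set.Iic (0 : ℝ), w y) + ∫ y in (0 : ℝ)..x, w y := by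
        ext x
        rw [← intervalIntegral.integral_Iic_sub_Iic hwi.integrableOn hwi.integrableOn]
        ring
      refine HasStrictDerivAt.div_const ?_ _
      rw [h1]
      exact (intervalIntegral.integral_hasStrictDerivAt_right (hw.intervalIntegrable _ _)
        hw.stronglyMeasurable.stronglyMeasurableAtFilter hw.continuousAt).const_add _
    refine ⟨hZ, fun x => (∫ y in Set.Iic x, w y) / ∫ x, w x, ?_, hderiv, ?_, ?_⟩
    · refine strictMono_of_deriv_pos fun x => ?_
      rw [(hderiv x).hasDerivAt.deriv]
      exact div_pos (hw0 x) hZ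
    · have := (aecover_Iic (μ := volume) (tendsto_id (α := ℝ) (x := atTop))
        ).integral_tendsto_of_countably_generated hwi
      simpa [div_self hZ.ne'] using this.div_const (∫ x, w x)
    · have := (aecover_Ioi (μ := volume) (tendsto_id (α := ℝ) (x := atBot))
        ).integral_tendsto_of_countably_generated hwi
      have h2 := (this.const_sub (∫ x, w x)).div_const (∫ x, w x)
      rw [sub_self, zero_div] at h2
      refine h2.congr fun x => ?_
      rw [← integral_add_compl (measurableSet_Iic (a := x)) hwi, Set.compl_Iic]
      simp
  obtain ⟨hZu, U, hU, hU', hU1, hU0⟩ := key hu hu0 hui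
  obtain ⟨hZv, V, hV, hV', hV1, hV0⟩ := key hv hv0 hvi
  have hex : ∀ y, ∃ x, U x = V y := by
    intro y
    have hV_pos : 0 < V y :=
      lt_of_le_of_lt (hV.monotone.le_of_tendsto hV0 (y - 1)) (hV (by linarith))
    have hV_lt : V y < 1 :=
      lt_of_lt_of_le (hV (by linarith : y < y + 1)) (hV.monotone.ge_of_tendsto hV1 (y + 1))
    have hUc : Continuous U :=
      continuous_iff_continuousAt.2 fun x => (hU' x).hasDerivAt.continuousAt
    obtain ⟨a, ha⟩ := (hU0.eventually (gt_mem_nhds hV_pos)).exists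
    obtain ⟨b, hb⟩ := (hU1.eventually (lt_mem_nhds hV_lt)).exists
    exact mem_range_of_exists_le_of_exists_ge hUc ⟨a, ha.le⟩ ⟨b, hb.le⟩
  choose T hT using hex
  refine ⟨T, fun x y hxy => ?_, fun y => ?_⟩
  · rw [← hU.lt_iff_lt, hT, hT]
    exact hV hxy
  · have hne : u (T y) / (∫ x, u x) ≠ 0 := (div_pos (hu0 _) hZu).ne'
    have hVc : Tendsto V (𝓝 y) (𝓝 (U (T y))) := by
      rw [hT]
      exact (hV' y).hasDerivAt.continuousAt
    have h1 := (hU' (T y)).to_localInverse hne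
    have h2 := hVc.eventually ((hU' (T y)).eventually_right_inverse hne)
    have h3 : (fun x => (hU' (T y)).localInverse U _ _ hne (V x)) =ᶠ[𝓝 y] T := by
      filter_upwards [h2] with x hx
      exact hU.injective (hx.trans (hT x).symm)
    rw [hT] at h1
    have h4 := (h1.hasDerivAt.comp y (hV' y).hasDerivAt).congr_of_eventuallyEq h3.symm
    rwa [inv_mul_eq_div] at h4

/-- The Prékopa–Leindler inequality on `ℝ` for positive continuous functions. -/
theorem prekopa_leindler_real {u v w : ℝ → ℝ} {a t : ℝ} (ha : 0 < a) (ht : 0 < t)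
    (hat : a + t = 1) (hu : Continuous u) (hv : Continuous v)
    (hu0 : ∀ x, 0 < u x) (hv0 : ∀ x, 0 < v x) (hui : Integrable u) (hvi : Integrable v)
    (hw0 : ∀ x, 0 ≤ w x) (hwi : Integrable w)
    (h : ∀ x y, u x ^ a * v y ^ t ≤ w (a * x + t * y)) :
    (∫ x, u x) ^ a * (∫ x, v x) ^ t ≤ ∫ x, w x := by
  obtain ⟨T, hT, hT'⟩ := exists_monotone_transport hu hv hu0 hv0 hui hvi
  have hZu : 0 < ∫ x, u x :=
    integral_pos_of_integrable_nonneg_nonzero hu hui (fun x => (hu0 x).le) (hu0 0).ne'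
  have hZv : 0 < ∫ x, v x :=
    integral_pos_of_integrable_nonneg_nonzero hv hvi (fun x => (hv0 x).le) (hv0 0).ne'
  set Zu := ∫ x, u x
  set Zv := ∫ x, v x
  set T' : ℝ → ℝ := fun y => (v y / Zv) / (u (T y) / Zu) with hT'def
  have hT'0 : ∀ y, 0 < T' y := fun y => div_pos (div_pos (hv0 _) hZv) (div_pos (hu0 _) hZu)
  set z : ℝ → ℝ := fun y => a * T y + t * y with hz
  have hz' : ∀ y ∈ Set.univ, HasDerivWithinAt z (a * T' y + t) Set.univ y := by
    intro y _
    have := ((hT' y).const_mul a).add ((hasDerivAt_id y).const_mul t)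
    rw [mul_one] at this
    exact this.hasDerivWithinAt
  have hz'0 : ∀ y, 0 < a * T' y + t := fun y => by have := hT'0 y; positivity
  have hzi : Set.InjOn z Set.univ := by
    refine (StrictMono.injective fun x y hxy => ?_).injOn
    have h1 := mul_lt_mul_of_pos_left (hT hxy) ha
    have h2 := mul_lt_mul_of_pos_left hxy ht
    simp only [hz]
    linarith
  have hint := (integrableOn_image_iff_integrableOn_abs_deriv_smul
    MeasurableSet.univ hz' hzi w).1 hwi.integrableOn
  have hle : ∫ y, (Zu / Zv) ^ a * v y ≤ ∫ y, |a * T' y + t| • w (z y) := by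
    refine integral_mono (hvi.const_mul _) (by simpa using hint) fun y => ?_
    have h1 := Real.geom_mean_le_arith_mean2_weighted ha.le ht.le (hT'0 y).le zero_le_one hat
    rw [Real.one_rpow, mul_one, mul_one] at h1
    have h2 := mul_le_mul h1 (h (T y) y)
      (mul_nonneg (Real.rpow_nonneg (hu0 _).le _) (Real.rpow_nonneg (hv0 _).le _)) (hz'0 y).le
    simp only [smul_eq_mul, abs_of_pos (hz'0 y)]
    refine le_trans (le_of_eq ?_) h2
    have h3 : T' y * u (T y) = (Zu / Zv) * v y := by
      have := (hu0 (T y)).ne'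
      simp only [hT'def]
      field_simp
    rw [← mul_assoc, ← Real.mul_rpow (hT'0 y).le (hu0 _).le, h3,
      Real.mul_rpow (div_pos hZu hZv).le (hv0 y).le, mul_assoc, ← Real.rpow_add (hv0 y), hat,
      Real.rpow_one]
  calc Zu ^ a * Zv ^ t = ∫ y, (Zu / Zv) ^ a * v y := by
        rw [integral_const_mul, Real.div_rpow hZu.le hZv.le, div_mul_eq_mul_div, mul_div_assoc]
        congr 1
        rw [eq_div_iff (Real.rpow_pos_of_pos hZv a).ne', ← Real.rpow_add hZv, add_comm, hat,
          Real.rpow_one]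
    _ ≤ ∫ y, |a * T' y + t| • w (z y) := hle
    _ = ∫ x in z '' Set.univ, w x := by
        rw [integral_image_eq_integral_abs_deriv_smul MeasurableSet.univ hz' hzi,
          setIntegral_univ]
    _ ≤ ∫ x, w x := setIntegral_le_integral hwi (Filter.Eventually.of_forall hw0)

theorem MeasureTheory.Integrable.of_exp {Ω : Type*} {m : MeasurableSpace Ω} {μ : Measure Ω}
    {f : Ω → ℝ} (hf : AEStronglyMeasurable f μ) (h1 : Integrable (fun x => Real.exp (f x)) μ)
    (h2 : Integrable (fun x => Real.exp (-f x)) μ) : Integrable f μ := by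
  refine (h1.add h2).mono' hf (Filter.Eventually.of_forall fun x => ?_)
  have h3 := Real.add_one_le_exp (f x)
  have h4 := Real.add_one_le_exp (-f x)
  have h5 := Real.exp_pos (f x)
  have h6 := Real.exp_pos (-f x)
  simp only [Real.norm_eq_abs, Pi.add_apply]
  exact abs_le.2 ⟨by linarith, by linarith⟩

namespace ProbabilityTheory

theorem integrable_exp_mul_abs_gaussianReal (c : ℝ) :
    Integrable (fun x : ℝ => Real.exp (c * |x|)) (gaussianReal 0 1) :=
  integrable_exp_mul_abs (X := fun x => x) (integrable_exp_mul_gaussianReal c)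
    (integrable_exp_mul_gaussianReal (-c))

/-- The standard Gaussian measure on `Fin n → ℝ`. -/
noncomputable abbrev stdGaussianPi (n : ℕ) : Measure (Fin n → ℝ) :=
  Measure.pi fun _ : Fin n => gaussianReal 0 1

theorem integrable_exp_gaussianReal_of_lipschitz {f : ℝ → ℝ} {K : NNReal}
    (hf : LipschitzWith K f) : Integrable (fun x => Real.exp (f x)) (gaussianReal 0 1) := by
  refine ((integrable_exp_mul_abs_gaussianReal K).const_mul (Real.exp (f 0))).mono'
    (by have := hf.continuous; fun_prop) (Filter.Eventually.of_forall fun x => ?_)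
  rw [Real.norm_eq_abs, Real.abs_exp, ← Real.exp_add, Real.exp_le_exp]
  simpa using hf.le_add_mul x 0

theorem integrable_exp_stdGaussianPi_of_lipschitz {n : ℕ} {f : (Fin n → ℝ) → ℝ} {K : NNReal}
    (hf : LipschitzWith K f) : Integrable (fun x => Real.exp (f x)) (stdGaussianPi n) := by
  have h1 : Integrable (fun x : Fin n → ℝ => ∏ i, Real.exp (K * |x i|)) (stdGaussianPi n) :=
    Integrable.fintype_prod (f := fun _ y => Real.exp (K * |y|))
      fun _ => integrable_exp_mul_abs_gaussianReal K
  refine (h1.const_mul (Real.exp (f 0))).mono'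
    (by have := hf.continuous; fun_prop) (Filter.Eventually.of_forall fun x => ?_)
  rw [Real.norm_eq_abs, Real.abs_exp, ← Real.exp_sum, ← Real.exp_add, Real.exp_le_exp,
    ← Finset.mul_sum]
  refine (hf.le_add_mul x 0).trans ?_
  gcongr
  rw [dist_zero_right]
  refine (pi_norm_le_iff_of_nonneg (Finset.sum_nonneg fun i _ => abs_nonneg (x i))).2 fun i => ?_
  exact Finset.single_le_sum (f := fun i => |x i|) (fun i _ => abs_nonneg _) (Finset.mem_univ i)

theorem integrable_gaussianReal_of_lipschitz {f : ℝ → ℝ} {K : NNReal}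
    (hf : LipschitzWith K f) : Integrable f (gaussianReal 0 1) :=
  .of_exp hf.continuous.aestronglyMeasurable (integrable_exp_gaussianReal_of_lipschitz hf)
    (integrable_exp_gaussianReal_of_lipschitz hf.neg)

theorem integrable_stdGaussianPi_of_lipschitz {n : ℕ} {f : (Fin n → ℝ) → ℝ} {K : NNReal}
    (hf : LipschitzWith K f) : Integrable f (stdGaussianPi n) :=
  .of_exp hf.continuous.aestronglyMeasurable (integrable_exp_stdGaussianPi_of_lipschitz hf)
    (integrable_exp_stdGaussianPi_of_lipschitz hf.neg)

theorem exp_integral_le {Ω : Type*} {m : MeasurableSpace Ω} {μ : Measure Ω}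
    [IsProbabilityMeasure μ] {f : Ω → ℝ} (hf : Integrable f μ)
    (hef : Integrable (fun x => Real.exp (f x)) μ) :
    Real.exp (∫ x, f x ∂μ) ≤ ∫ x, Real.exp (f x) ∂μ :=
  convexOn_exp.map_integral_le Real.continuous_exp.continuousOn isClosed_univ (by simp) hf hef

/-- Dual form of Talagrand's transport inequality for the Gaussian measure on `ℝ`. -/
theorem integral_exp_gaussianReal_le {t : ℝ} (ht0 : 0 < t) (ht1 : t < 1) {f h : ℝ → ℝ}
    {K K' : NNReal} (hf : LipschitzWith K f) (hh : LipschitzWith K' h)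
    (hfh : ∀ x y, h x ≤ f y + t / 2 * (x - y) ^ 2) :
    ∫ x, Real.exp (h x) ∂(gaussianReal 0 1) ≤ Real.exp (∫ x, f x ∂(gaussianReal 0 1)) := by
  set a := 1 - t with ha_def
  have ha : 0 < a := by linarith
  have hfc := hf.continuous
  have hhc := hh.continuous
  set φ := gaussianPDFReal 0 1 with hφ
  have hφc : Continuous φ := by
    rw [hφ, gaussianPDFReal_def]
    fun_prop
  have hφ0 : ∀ x, 0 < φ x := fun x => gaussianPDFReal_pos 0 1 x one_ne_zero
  obtain ⟨L, hL⟩ : ∃ L : ℝ, ∀ x, φ x = Real.exp (L - x ^ 2 / 2) := by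
    refine ⟨Real.log (√(2 * Real.pi))⁻¹, fun x => ?_⟩
    rw [sub_eq_add_neg, Real.exp_add, Real.exp_log (by positivity)]
    simp [hφ, gaussianPDFReal, neg_div]
  have htrans : ∀ g : ℝ → ℝ, Integrable g (gaussianReal 0 1) →
      Integrable (fun x => φ x * g x) := by
    intro g hg
    rw [gaussianReal_of_var_ne_zero 0 one_ne_zero, integrable_withDensity_iff_integrable_smul'
      (measurable_gaussianPDF 0 1) (by simp [gaussianPDF])] at hg
    simpa [toReal_gaussianPDF] using hg
  have hint : ∀ g : ℝ → ℝ, ∫ x, g x ∂(gaussianReal 0 1) = ∫ x, φ x * g x := fun g => by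
    rw [integral_gaussianReal_eq_integral_smul one_ne_zero]
    rfl
  have hcf : LipschitzWith (‖-(a / t)‖₊ * K) (fun x => -(a / t) * f x) :=
    (lipschitzWith_smul (-(a / t))).comp hf
  have hexph := integrable_exp_gaussianReal_of_lipschitz hh
  have hexpf := integrable_exp_gaussianReal_of_lipschitz hcf
  have hPL := prekopa_leindler_real (u := fun x => φ x * Real.exp (h x))
    (v := fun x => φ x * Real.exp (-(a / t) * f x)) (w := φ) ha ht0 (by ring)
    (by fun_prop) (by fun_prop) (fun x => mul_pos (hφ0 x) (Real.exp_pos _))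
    (fun x => mul_pos (hφ0 x) (Real.exp_pos _)) (htrans _ hexph) (htrans _ hexpf)
    (fun x => (hφ0 x).le) (integrable_gaussianPDFReal 0 1) (fun x y => by
      simp only [hL, ← Real.exp_add, ← Real.exp_mul]
      rw [Real.exp_le_exp]
      have h1 := mul_le_mul_of_nonneg_left (hfh x y) ha.le
      have h2 : -(a / t) * f y * t = -(a * f y) := by field_simp
      rw [add_mul _ _ t, h2, ha_def]
      rw [ha_def] at h1
      linarith)
  rw [← hint, ← hint, integral_gaussianPDFReal_eq_one 0 one_ne_zero] at hPL
  have hJ := exp_integral_le (integrable_gaussianReal_of_lipschitz hcf) hexpf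
  rw [integral_const_mul] at hJ
  have hA : 0 ≤ ∫ x, Real.exp (h x) ∂(gaussianReal 0 1) :=
    integral_nonneg fun x => (Real.exp_pos _).le
  rw [← Real.rpow_le_rpow_iff hA (Real.exp_pos _).le ha, ← Real.exp_mul]
  have h3 := Real.rpow_le_rpow (Real.exp_pos _).le hJ ht0.le
  rw [← Real.exp_mul] at h3
  have h4 := (mul_le_mul_of_nonneg_left h3 (Real.rpow_nonneg hA a)).trans hPL
  have h5 : -(a / t) * (∫ x, f x ∂(gaussianReal 0 1)) * t
      = -((∫ x, f x ∂(gaussianReal 0 1)) * a) := by field_simp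
  rw [h5, Real.exp_neg, ← div_eq_mul_inv, div_le_one (Real.exp_pos _)] at h4
  exact h4

theorem dist_cons_left {n : ℕ} (a b : ℝ) (x : Fin n → ℝ) :
    dist (Fin.cons a x : Fin (n + 1) → ℝ) (Fin.cons b x) = dist a b := by
  refine le_antisymm ((dist_pi_le_iff dist_nonneg).2 ?_) ?_
  · simp [Fin.forall_fin_succ]
  · simpa using dist_le_pi_dist (Fin.cons a x : Fin (n + 1) → ℝ) (Fin.cons b x) 0

theorem lipschitzWith_cons {n : ℕ} (a : ℝ) :
    LipschitzWith 1 (fun x : Fin n → ℝ => (Fin.cons a x : Fin (n + 1) → ℝ)) := by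
  refine LipschitzWith.mk_one fun x y => (dist_pi_le_iff dist_nonneg).2 ?_
  simp [Fin.forall_fin_succ, dist_le_pi_dist]

theorem integral_stdGaussianPi_succ {n : ℕ} {g : (Fin (n + 1) → ℝ) → ℝ}
    (hg : Integrable g (stdGaussianPi (n + 1))) :
    ∫ x, g x ∂(stdGaussianPi (n + 1))
      = ∫ a, ∫ x, g (Fin.cons a x) ∂(stdGaussianPi n) ∂(gaussianReal 0 1) := by
  have hmp := (measurePreserving_piFinSuccAbove
    (fun _ : Fin (n + 1) => gaussianReal 0 1) 0).symm
  rw [← hmp.integral_comp', integral_prod]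
  · simp [MeasurableEquiv.piFinSuccAbove, Fin.insertNthEquiv]
  · exact (hmp.integrable_comp_emb (MeasurableEquiv.measurableEmbedding _)).2 hg

/-- Dual form of Talagrand's transport inequality for the standard Gaussian measure. -/
theorem integral_exp_stdGaussianPi_le {t : ℝ} (ht0 : 0 < t) (ht1 : t < 1) {n : ℕ}
    {f h : (Fin n → ℝ) → ℝ} {K K' : NNReal} (hf : LipschitzWith K f) (hh : LipschitzWith K' h)
    (hfh : ∀ x y, h x ≤ f y + t / 2 * ∑ i, (x i - y i) ^ 2) :
    ∫ x, Real.exp (h x) ∂(stdGaussianPi n) ≤ Real.exp (∫ x, f x ∂(stdGaussianPi n)) := by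
  induction n with
  | zero =>
    have := hfh default default
    simp only [Finset.univ_eq_empty, Finset.sum_empty, mul_zero, add_zero] at this
    simp only [stdGaussianPi, Measure.pi_of_empty _ default, integral_dirac, Real.exp_le_exp]
    exact this
  | succ n ih =>
    have hhL : ∀ a, LipschitzWith K' (fun x => h (Fin.cons a x)) := fun a => by
      simpa [Function.comp_def] using hh.comp (lipschitzWith_cons a)
    have hfL : ∀ a, LipschitzWith K (fun x => f (Fin.cons a x)) := fun a => by
      simpa [Function.comp_def] using hf.comp (lipschitzWith_cons a)
    have hhI := fun a => integrable_exp_stdGaussianPi_of_lipschitz (hhL a)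
    have hfI := fun a => integrable_stdGaussianPi_of_lipschitz (hfL a)
    have hpos : ∀ a, 0 < ∫ x, Real.exp (h (Fin.cons a x)) ∂(stdGaussianPi n) := fun a =>
      integral_exp_pos (hhI a)
    set H : ℝ → ℝ := fun a => Real.log (∫ x, Real.exp (h (Fin.cons a x)) ∂(stdGaussianPi n))
      with hH
    set F : ℝ → ℝ := fun a => ∫ x, f (Fin.cons a x) ∂(stdGaussianPi n) with hF
    have hHL : LipschitzWith K' H := by
      refine LipschitzWith.of_le_add_mul _ fun a b => ?_
      rw [hH]
      dsimp only
      rw [Real.log_le_iff_le_exp (hpos a), Real.exp_add, Real.exp_log (hpos b),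
        ← integral_mul_const]
      refine integral_mono (hhI a) ((hhI b).mul_const _) fun x => ?_
      dsimp only
      rw [← Real.exp_add, Real.exp_le_exp, ← dist_cons_left a b x]
      exact hh.le_add_mul _ _
    have hFL : LipschitzWith K F := by
      refine LipschitzWith.of_le_add_mul _ fun a b => ?_
      have h1 : F b + K * dist a b
          = ∫ x, (f (Fin.cons b x) + K * dist a b) ∂(stdGaussianPi n) := by
        rw [integral_add (hfI b) (integrable_const _)]
        simp [hF]
      rw [h1]
      refine integral_mono (hfI a) ((hfI b).add (integrable_const _)) fun x => ?_
      dsimp only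
      rw [← dist_cons_left a b x]
      exact hf.le_add_mul _ _
    have hHF : ∀ a b, H a ≤ F b + t / 2 * (a - b) ^ 2 := by
      intro a b
      rw [hH]
      dsimp only
      rw [Real.log_le_iff_le_exp (hpos a)]
      have h1 := ih (f := fun x => f (Fin.cons b x) + t / 2 * (a - b) ^ 2)
        (h := fun x => h (Fin.cons a x))
        (LipschitzWith.of_le_add_mul _ fun x y => by
          have := (hfL b).le_add_mul x y
          linarith) (hhL a) (fun x y => by
          have := hfh (Fin.cons a x) (Fin.cons b y)
          rw [Fin.sum_univ_succ] at this
          simp only [Fin.cons_zero, Fin.cons_succ] at this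
          linarith)
      rw [integral_add (hfI b) (integrable_const _)] at h1
      simpa using h1
    rw [integral_stdGaussianPi_succ (integrable_exp_stdGaussianPi_of_lipschitz hh),
      integral_stdGaussianPi_succ (integrable_stdGaussianPi_of_lipschitz hf)]
    refine le_of_eq_of_le (integral_congr_ae (Filter.Eventually.of_forall fun a => ?_))
      (integral_exp_gaussianReal_le ht0 ht1 hFL hHL hHF)
    exact (Real.exp_log (hpos a)).symm

/-- A function which is `1`-Lipschitz in the Euclidean norm is Lipschitz in the sup norm. -/
theorem lipschitzWith_of_le_add_sqrt {n : ℕ} {f : (Fin n → ℝ) → ℝ}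
    (hf : ∀ x y, f x ≤ f y + √(∑ i, (x i - y i) ^ 2)) : LipschitzWith n f := by
  refine LipschitzWith.of_le_add_mul _ fun x y => (hf x y).trans ?_
  gcongr
  have h1 : ∑ i, (x i - y i) ^ 2 ≤ ∑ _i : Fin n, dist x y ^ 2 :=
    Finset.sum_le_sum fun i _ => by
      rw [← sq_abs, ← Real.dist_eq]
      exact pow_le_pow_left₀ dist_nonneg (dist_le_pi_dist x y i) 2
  refine Real.sqrt_le_iff.2 ⟨by positivity, h1.trans ?_⟩
  rw [Finset.sum_const, Finset.card_univ, Fintype.card_fin, nsmul_eq_mul, mul_pow,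
    NNReal.coe_natCast]
  gcongr
  exact_mod_cast Nat.le_self_pow two_ne_zero n

/-- Gaussian concentration for functions that are `1`-Lipschitz in the Euclidean norm. -/
theorem integral_exp_mul_sub_stdGaussianPi_le {t : ℝ} (ht0 : 0 < t) (ht1 : t < 1) {n : ℕ}
    {f : (Fin n → ℝ) → ℝ}
    (hfe : ∀ x y, f x ≤ f y + √(∑ i, (x i - y i) ^ 2)) {c : ℝ} (hc : 0 ≤ c) :
    ∫ x, Real.exp (c * (f x - ∫ y, f y ∂(stdGaussianPi n))) ∂(stdGaussianPi n)
      ≤ Real.exp (c ^ 2 / (2 * t)) := by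
  have hf := lipschitzWith_of_le_add_sqrt hfe
  set m := ∫ y, f y ∂(stdGaussianPi n) with hm
  have hL : ∀ d : ℝ, LipschitzWith (c.toNNReal * n) (fun x => c * f x - d) := fun d =>
    LipschitzWith.of_le_add_mul _ fun x y => by
      have := mul_le_mul_of_nonneg_left (hf.le_add_mul x y) hc
      rw [NNReal.coe_mul, Real.coe_toNNReal _ hc]
      linarith
  have h1 := integral_exp_stdGaussianPi_le ht0 ht1 (hL (c * m))
    (hL (c * m + c ^ 2 / (2 * t))) fun x y => by
      have h2 := mul_le_mul_of_nonneg_left (hfe x y) hc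
      have hS : 0 ≤ ∑ i, (x i - y i) ^ 2 := Finset.sum_nonneg fun i _ => sq_nonneg _
      set s := √(∑ i, (x i - y i) ^ 2) with hs
      rw [← Real.sq_sqrt hS, ← hs]
      have h3 : c * s ≤ c ^ 2 / (2 * t) + t / 2 * s ^ 2 := by
        have h4 : c ^ 2 / (2 * t) + t / 2 * s ^ 2 - c * s = (c - t * s) ^ 2 / (2 * t) := by
          field_simp
          ring
        have h5 : 0 ≤ (c - t * s) ^ 2 / (2 * t) := by positivity
        linarith
      linarith
  have hi := integrable_stdGaussianPi_of_lipschitz hf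
  rw [integral_sub (hi.const_mul c) (integrable_const _), integral_const_mul, ← hm] at h1
  simp only [integral_const, probReal_univ, one_smul, sub_self, Real.exp_zero] at h1
  calc ∫ x, Real.exp (c * (f x - m)) ∂(stdGaussianPi n)
      = ∫ x, Real.exp (c * f x - (c * m + c ^ 2 / (2 * t))) * Real.exp (c ^ 2 / (2 * t))
          ∂(stdGaussianPi n) := by
        congr 1
        ext x
        rw [← Real.exp_add]
        ring_nf
    _ ≤ 1 * Real.exp (c ^ 2 / (2 * t)) := by
        rw [integral_mul_const]
        gcongr
    _ = _ := one_mul _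

theorem le_iSup_add_sqrt {ι : Type*} [Finite ι] [Nonempty ι] {n : ℕ}
    {f : ι → (Fin n → ℝ) → ℝ} (hf : ∀ j x y, f j x ≤ f j y + √(∑ i, (x i - y i) ^ 2))
    (x y : Fin n → ℝ) : ⨆ j, f j x ≤ (⨆ j, f j y) + √(∑ i, (x i - y i) ^ 2) :=
  ciSup_le fun j => (hf j x y).trans <|
    add_le_add_left (le_ciSup (f := fun j => f j y) (Set.finite_range _).bddAbove j) _

/-- The expected maximum of finitely many functions that are `1`-Lipschitz in the Euclidean
norm. -/
theorem integral_iSup_stdGaussianPi_le {ι : Type*} [Fintype ι] [Nonempty ι] {n : ℕ}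
    {f : ι → (Fin n → ℝ) → ℝ} (hf : ∀ j x y, f j x ≤ f j y + √(∑ i, (x i - y i) ^ 2))
    {m : ℝ} (hm : ∀ j, ∫ x, f j x ∂(stdGaussianPi n) ≤ m) :
    ∫ x, (⨆ j, f j x) ∂(stdGaussianPi n)
      ≤ m + √(2 * Real.log (Fintype.card ι)) + √(Real.pi / 2) := by
  have hML := lipschitzWith_of_le_add_sqrt (le_iSup_add_sqrt hf)
  have hfL := fun j => lipschitzWith_of_le_add_sqrt (hf j)
  have hcard : (1 : ℝ) ≤ Fintype.card ι := by exact_mod_cast Fintype.card_pos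
  have hlog : 0 ≤ Real.log (Fintype.card ι) := Real.log_nonneg hcard
  set s := √(2 * Real.log (Fintype.card ι)) with hs
  have hs0 : 0 ≤ s := Real.sqrt_nonneg _
  have hs2 : s ^ 2 = 2 * Real.log (Fintype.card ι) := Real.sq_sqrt (by positivity)
  set c := s + 1 with hc
  have hc0 : 0 < c := by positivity
  have hexpL : ∀ {g : (Fin n → ℝ) → ℝ} (_ : LipschitzWith n g) (d : ℝ),
      LipschitzWith (c.toNNReal * n) (fun x => c * (g x - d)) := fun hg d =>
    LipschitzWith.of_le_add_mul _ fun x y => by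
      have := mul_le_mul_of_nonneg_left (hg.le_add_mul x y) hc0.le
      rw [NNReal.coe_mul, Real.coe_toNNReal _ hc0.le]
      linarith
  have hMi := integrable_stdGaussianPi_of_lipschitz hML
  have hJ := exp_integral_le (integrable_stdGaussianPi_of_lipschitz (hexpL hML m))
    (integrable_exp_stdGaussianPi_of_lipschitz (hexpL hML m))
  rw [integral_const_mul, integral_sub hMi (integrable_const _)] at hJ
  simp only [integral_const, probReal_univ, one_smul] at hJ
  set E := ∫ x, (⨆ j, f j x) ∂(stdGaussianPi n)
  have ht0 : 0 < c / (c + 1 / 2) := by positivity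
  have ht1 : c / (c + 1 / 2) < 1 := by
    rw [div_lt_one (by positivity)]
    linarith
  have hbound : ∫ x, Real.exp (c * ((⨆ j, f j x) - m)) ∂(stdGaussianPi n)
      ≤ Fintype.card ι * Real.exp (c * (c + 1 / 2) / 2) := by
    have hint : ∀ j, Integrable (fun x => Real.exp (c * (f j x - m))) (stdGaussianPi n) :=
      fun j => integrable_exp_stdGaussianPi_of_lipschitz (hexpL (hfL j) m)
    calc ∫ x, Real.exp (c * ((⨆ j, f j x) - m)) ∂(stdGaussianPi n)
        ≤ ∫ x, ∑ j, Real.exp (c * (f j x - m)) ∂(stdGaussianPi n) := by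
          refine integral_mono (integrable_exp_stdGaussianPi_of_lipschitz (hexpL hML m))
            (integrable_finsetSum _ fun j _ => hint j) fun x => ?_
          obtain ⟨j, hj⟩ := exists_eq_ciSup_of_finite (f := fun j => f j x)
          dsimp only
          rw [← hj]
          exact Finset.single_le_sum (f := fun j => Real.exp (c * (f j x - m)))
            (fun _ _ => (Real.exp_pos _).le) (Finset.mem_univ j)
      _ = ∑ j, ∫ x, Real.exp (c * (f j x - m)) ∂(stdGaussianPi n) :=
          integral_finsetSum _ fun j _ => hint j
      _ ≤ ∑ _j : ι, Real.exp (c * (c + 1 / 2) / 2) := by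
          refine Finset.sum_le_sum fun j _ => ?_
          have h1 := integral_exp_mul_sub_stdGaussianPi_le ht0 ht1 (hf j) hc0.le
          have h2 : c ^ 2 / (2 * (c / (c + 1 / 2))) = c * (c + 1 / 2) / 2 := by field_simp
          rw [h2] at h1
          refine le_trans (integral_mono (hint j) (integrable_exp_stdGaussianPi_of_lipschitz
            (hexpL (hfL j) _)) fun x => ?_) h1
          have := hm j
          dsimp only
          gcongr
      _ = _ := by simp
  have h1 := hJ.trans hbound
  rw [← Real.exp_log (by positivity : (0 : ℝ) < Fintype.card ι), ← Real.exp_add,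
    Real.exp_le_exp] at h1
  have h2 : c * (E - m) ≤ c * (s + 3 / 4) := by
    rw [hc] at h1 ⊢
    linarith
  have h3 := le_of_mul_le_mul_left h2 hc0
  have h4 : 3 / 4 ≤ √(Real.pi / 2) := by
    refine Real.le_sqrt_of_sq_le ?_
    linarith [Real.pi_gt_three]
  linarith

end ProbabilityTheory

/-- The support function of a set in Euclidean space. -/
noncomputable def supportFun {p : ℕ} (T : Set (EuclideanSpace ℝ (Fin p))) (g : Fin p → ℝ) : ℝ :=
  sSup ((fun u : EuclideanSpace ℝ (Fin p) => ∑ i, g i * u i) '' T)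

theorem sum_mul_le_sqrt_mul_norm {p : ℕ} (g : Fin p → ℝ) (u : EuclideanSpace ℝ (Fin p)) :
    ∑ i, g i * u i ≤ √(∑ i, g i ^ 2) * ‖u‖ := by
  rw [EuclideanSpace.norm_eq]
  simpa using Real.sum_mul_le_sqrt_mul_sqrt Finset.univ g u

theorem bddAbove_sum_mul_image {p : ℕ} {T : Set (EuclideanSpace ℝ (Fin p))}
    (hT : T ⊆ Metric.closedBall 0 1) (g : Fin p → ℝ) :
    BddAbove ((fun u : EuclideanSpace ℝ (Fin p) => ∑ i, g i * u i) '' T) := by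
  refine ⟨√(∑ i, g i ^ 2), ?_⟩
  rintro _ ⟨u, hu, rfl⟩
  exact (sum_mul_le_sqrt_mul_norm g u).trans
    (mul_le_of_le_one_right (Real.sqrt_nonneg _) (mem_closedBall_zero_iff.1 (hT hu)))

theorem supportFun_le_add_sqrt {p : ℕ} {T : Set (EuclideanSpace ℝ (Fin p))}
    (hT : T ⊆ Metric.closedBall 0 1) (hT0 : T.Nonempty) (x y : Fin p → ℝ) :
    supportFun T x ≤ supportFun T y + √(∑ i, (x i - y i) ^ 2) := by
  refine csSup_le (hT0.image _) ?_
  rintro _ ⟨u, hu, rfl⟩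
  have h1 := (sum_mul_le_sqrt_mul_norm (fun i => x i - y i) u).trans
    (mul_le_of_le_one_right (Real.sqrt_nonneg _) (mem_closedBall_zero_iff.1 (hT hu)))
  have h2 := le_csSup (bddAbove_sum_mul_image hT y) ⟨u, hu, rfl⟩
  simp only [sub_mul, Finset.sum_sub_distrib] at h1
  simp only [supportFun]
  linarith

theorem IsCone.sum_mul_le_norm_mul_supportFun {p : ℕ} {C : Set (EuclideanSpace ℝ (Fin p))}
    (hC : IsCone C) (g : Fin p → ℝ) {v : EuclideanSpace ℝ (Fin p)} (hv : v ∈ C) :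
    ∑ i, g i * v i ≤ ‖v‖ * supportFun (C ∩ Metric.closedBall 0 1) g := by
  rcases eq_or_ne v 0 with rfl | hv0
  · simp
  have hpos : 0 < ‖v‖ := norm_pos_iff.2 hv0
  have hmem : ‖v‖⁻¹ • v ∈ C ∩ Metric.closedBall 0 1 := by
    refine ⟨hC.2 _ (inv_nonneg.2 hpos.le) v hv, mem_closedBall_zero_iff.2 ?_⟩
    rw [norm_smul, norm_inv, norm_norm, inv_mul_cancel₀ hpos.ne']
  have h1 := le_csSup (bddAbove_sum_mul_image Set.inter_subset_right g) ⟨_, hmem, rfl⟩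
  have h2 : ∑ i, g i * (‖v‖⁻¹ • v) i = ‖v‖⁻¹ * ∑ i, g i * v i := by
    rw [Finset.mul_sum]
    exact Finset.sum_congr rfl fun i _ => by simp only [PiLp.smul_apply, smul_eq_mul]; ring
  dsimp only at h1
  rw [h2, inv_mul_le_iff₀ hpos] at h1
  exact h1

theorem IsCone.supportFun_nonneg {p : ℕ} {C : Set (EuclideanSpace ℝ (Fin p))}
    (hC : IsCone C) (g : Fin p → ℝ) : 0 ≤ supportFun (C ∩ Metric.closedBall 0 1) g :=
  le_csSup (bddAbove_sum_mul_image Set.inter_subset_right g) ⟨0, ⟨hC.1, by simp⟩, by simp⟩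

/-- For closed cones `C₁,…,C_k` and
`H̄ = {Σ u_i : u_i ∈ C_i, Σ‖u_i‖ ≤ 1}`, the Gaussian width satisfies
`w(H̄) ≤ max_i w(C_i ∩ B_p) + √(2 log k) + √(π/2)`. -/
theorem statement8 {p k : ℕ} (hk : 1 ≤ k)
    (C : Fin k → Set (EuclideanSpace ℝ (Fin p)))
    (hC : ∀ i, IsCone (C i)) (hclosed : ∀ i, IsClosed (C i)) :
    gaussianWidth {u | ∃ v : Fin k → EuclideanSpace ℝ (Fin p),
        (∀ i, v i ∈ C i) ∧ (∑ i, ‖v i‖) ≤ 1 ∧ u = ∑ i, v i}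
      ≤ (⨆ i, gaussianWidth (C i ∩ Metric.closedBall (0 : EuclideanSpace ℝ (Fin p)) 1))
        + Real.sqrt (2 * Real.log k) + Real.sqrt (Real.pi / 2) := by
  have : Nonempty (Fin k) := ⟨⟨0, hk⟩⟩
  set f : Fin k → (Fin p → ℝ) → ℝ := fun i => supportFun (C i ∩ Metric.closedBall 0 1)
  have hf : ∀ j x y, f j x ≤ f j y + √(∑ i, (x i - y i) ^ 2) := fun j =>
    supportFun_le_add_sqrt Set.inter_subset_right ⟨0, (hC j).1, by simp⟩
  have hmax := ProbabilityTheory.integral_iSup_stdGaussianPi_le hf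
    (m := ⨆ i, gaussianWidth (C i ∩ Metric.closedBall (0 : EuclideanSpace ℝ (Fin p)) 1))
    (fun j => le_ciSup (f := fun i => gaussianWidth (C i ∩ Metric.closedBall 0 1))
      (Set.finite_range _).bddAbove j)
  rw [Fintype.card_fin] at hmax
  refine le_trans (integral_mono_of_nonneg (Filter.Eventually.of_forall fun g => ?_)
    (ProbabilityTheory.integrable_stdGaussianPi_of_lipschitz
      (ProbabilityTheory.lipschitzWith_of_le_add_sqrt (ProbabilityTheory.le_iSup_add_sqrt hf)))
    (Filter.Eventually.of_forall fun g => ?_)) hmax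
  · refine Real.sSup_nonneg' ⟨0, ⟨0, ⟨fun _ => 0, fun i => (hC i).1, by simp, by simp⟩, ?_⟩, le_rfl⟩
    simp
  · have hle : ∀ i, f i g ≤ ⨆ j, f j g := fun i =>
      le_ciSup (f := fun j => f j g) (Set.finite_range _).bddAbove i
    have h0 : 0 ≤ ⨆ j, f j g := ((hC ⟨0, hk⟩).supportFun_nonneg g).trans (hle _)
    refine Real.sSup_le ?_ h0
    rintro _ ⟨_, ⟨v, hv, hv1, rfl⟩, rfl⟩
    calc ∑ i, g i * (∑ j, v j : EuclideanSpace ℝ (Fin p)) i = ∑ j, ∑ i, g i * v j i := by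
          rw [Finset.sum_comm]
          simp [Finset.mul_sum]
      _ ≤ ∑ j, ‖v j‖ * ⨆ j, f j g := Finset.sum_le_sum fun j _ =>
          ((hC j).sum_mul_le_norm_mul_supportFun g (hv j)).trans
            (mul_le_mul_of_nonneg_left (hle j) (norm_nonneg _))
      _ = (∑ j, ‖v j‖) * ⨆ j, f j g := by rw [Finset.sum_mul]
      _ ≤ ⨆ j, f j g := mul_le_of_le_one_left h0 hv1
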